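/- arXiv:1812.11491 — 2 statements merged into one kernel-verified Lean document; each statement's English description precedes it below -/
import Mathlib

section
/- For every a ∈ A, the constant polynomial C(a) belongs to N if and only if a ∈ N1 ∩ N2; equivalently, N ∩ C(A) = C(N1 ∩ N2). (This is part (i) of the paper's Proposition 2.6, stated there for a solvable polynomial algebra A; only the ring structure of A and the centrality of t are used.) -/
theorem RingHom.apply_mem_of_mem_span {R S : Type*} [Semiring R] [Semiring S] (φ : R →+* S)
    {s : Set R} {M : Submodule S S} (h : ∀ x ∈ s, φ x ∈ M) {p : R}
    (hp : p ∈ Submodule.span R s) : φ p ∈ M := by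
  induction hp using Submodule.span_induction with
  | mem x hx => exact h x hx
  | zero => simp
  | add x y _ _ hx hy => simpa using M.add_mem hx hy
  | smul r x _ hx => simpa using M.smul_mem (φ r) hx


/-- Proposition 2.6(i): for left ideals `N1`, `N2` of `A`, and `N` the left ideal of `A[t]`
generated by `{t·u : u ∈ N1} ∪ {(1 − t)·v : v ∈ N2}`, one has `N ∩ A = N1 ∩ N2`. -/
theorem intersection_of_left_ideals_via_elimination {K A : Type*} [Field K] [Ring A]
    [Algebra K A] (N1 N2 : Submodule A A)
    (N : Submodule (Polynomial A) (Polynomial A))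
    (hN : N = Submodule.span (Polynomial A)
      ((fun u : A => Polynomial.X * Polynomial.C u) '' (N1 : Set A) ∪
        (fun v : A => (1 - Polynomial.X) * Polynomial.C v) '' (N2 : Set A))) :
    ∀ a : A, Polynomial.C a ∈ N ↔ a ∈ N1 ⊓ N2 := by
  intro a
  subst hN
  constructor
  · intro ha
    constructor
    · have := RingHom.apply_mem_of_mem_span
        (Polynomial.eval₂RingHom' (RingHom.id A) 1 fun b => Commute.one_right b)
        (M := N1) ?_ ha
      · simpa using this
      · rintro _ (⟨u, hu, rfl⟩ | ⟨v, -, rfl⟩)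
        · simpa using hu
        · simp only [map_mul, map_sub, map_one]
          simp
    · have := RingHom.apply_mem_of_mem_span
        (Polynomial.eval₂RingHom' (RingHom.id A) 0 fun b => Commute.zero_right b)
        (M := N2) ?_ ha
      · simpa using this
      · rintro _ (⟨u, -, rfl⟩ | ⟨v, hv, rfl⟩)
        · simp
        · simpa using hv
  · rintro ⟨h1, h2⟩
    have key : (Polynomial.C a : Polynomial A)
        = Polynomial.X * Polynomial.C a + (1 - Polynomial.X) * Polynomial.C a := by
      noncomm_ring
    rw [key]
    exact add_mem (Submodule.subset_span (Or.inl ⟨a, h1, rfl⟩))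
      (Submodule.subset_span (Or.inr ⟨a, h2, rfl⟩))
end

section
/- For every x ∈ L, one has ι(x) ∈ N if and only if x ∈ N1 ∩ N2; that is, N ∩ ι(L) = ι(N1 ∩ N2). (This is part (i) of the paper's Proposition 4.5, stated there for a solvable polynomial algebra A; only the ring structure of A and the centrality of t are used.) -/
/-- A ring homomorphism applied componentwise sends the span of `S` into any submodule that
contains the image of `S`. -/
theorem Submodule.map_comp_mem_of_mem_span {R A ι : Type*} [Ring R] [Ring A] (φ : R →+* A)
    (M : Submodule A (ι → A)) {S : Set (ι → R)} (hS : ∀ w ∈ S, (fun i => φ (w i)) ∈ M)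
    {w : ι → R} (hw : w ∈ Submodule.span R S) : (fun i => φ (w i)) ∈ M := by
  induction hw using Submodule.span_induction with
  | mem w hw => exact hS w hw
  | zero =>
    simp only [Pi.zero_apply, map_zero]
    exact M.zero_mem
  | add w z _ _ hw hz =>
    simp only [Pi.add_apply, map_add]
    exact M.add_mem hw hz
  | smul p w _ hw =>
    simp only [Pi.smul_apply, smul_eq_mul, map_mul]
    exact M.smul_mem (φ p) hw

/-- Evaluation at a central element is a ring homomorphism. -/
theorem Polynomial.exists_ringHom_C_X {A : Type*} [Ring A] (c : A) (hc : ∀ a, Commute a c) :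
    ∃ φ : Polynomial A →+* A, (∀ a, φ (Polynomial.C a) = a) ∧ φ Polynomial.X = c :=
  ⟨Polynomial.eval₂RingHom' (RingHom.id A) c hc, by simp, by simp⟩


/-- Proposition 4.5(i): for `A`-submodules `N1`, `N2` of the free module `L = Aⁿ`, and `N` the
`A[t]`-submodule of `L_t = A[t]ⁿ` generated by `{t • ι(u) : u ∈ N1} ∪ {(1 − t) • ι(v) : v ∈ N2}`,
one has `N ∩ ι(L) = ι(N1 ∩ N2)`, where `ι` applies the constant-coefficient embedding
componentwise. -/
theorem intersection_of_submodules_via_elimination {A : Type*} [Ring A] (s : ℕ)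
    (N1 N2 : Submodule A (Fin s → A))
    (N : Submodule (Polynomial A) (Fin s → Polynomial A))
    (hN : N = Submodule.span (Polynomial A)
      ((fun u : Fin s → A => (Polynomial.X : Polynomial A) • fun i => Polynomial.C (u i)) '' (N1 : Set (Fin s → A)) ∪
        (fun v : Fin s → A =>
          ((1 : Polynomial A) - Polynomial.X) • fun i => Polynomial.C (v i)) '' (N2 : Set (Fin s → A)))) :
    ∀ x : Fin s → A, (fun i => Polynomial.C (x i)) ∈ N ↔ x ∈ N1 ⊓ N2 := by
  subst hN
  refine fun x => ⟨fun hx => ⟨?_, ?_⟩, fun ⟨h1, h2⟩ => ?_⟩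
  · obtain ⟨φ, hC, hX⟩ := Polynomial.exists_ringHom_C_X (1 : A) Commute.one_right
    have h := Submodule.map_comp_mem_of_mem_span φ N1 (by
      rintro w (⟨u, hu, rfl⟩ | ⟨v, hv, rfl⟩)
      · simpa [hC, hX] using hu
      · simp only [Pi.smul_apply, smul_eq_mul, map_mul, map_sub, map_one, hX, sub_self, zero_mul]
        exact N1.zero_mem) hx
    simp only [hC] at h
    exact h
  · obtain ⟨φ, hC, hX⟩ := Polynomial.exists_ringHom_C_X (0 : A) Commute.zero_right
    have h := Submodule.map_comp_mem_of_mem_span φ N2 (by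
      rintro w (⟨u, hu, rfl⟩ | ⟨v, hv, rfl⟩)
      · simp only [Pi.smul_apply, smul_eq_mul, map_mul, hX, zero_mul]
        exact N2.zero_mem
      · simpa [hC, hX, sub_mul] using hv) hx
    simp only [hC] at h
    exact h
  · have h : (fun i => Polynomial.C (x i)) = (Polynomial.X : Polynomial A) •
        (fun i => Polynomial.C (x i)) +
        ((1 : Polynomial A) - Polynomial.X) • fun i => Polynomial.C (x i) := by
      rw [← add_smul, add_sub_cancel, one_smul]
    rw [h]
    exact Submodule.add_mem _ (Submodule.subset_span (Or.inl ⟨x, h1, rfl⟩))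
      (Submodule.subset_span (Or.inr ⟨x, h2, rfl⟩))
end
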